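/- arXiv:1612.04456 — 2 statements merged into one kernel-verified Lean document; each statement's English description precedes it below -/
import Mathlib

section
/- Let F be an (m,s)-function and let λ ∈ GF(2^s)\{0}. If 2^m − 2·nl(F) < n_{f_λ}, then the binary code C_{D_{f_λ}} has length n_{f_λ}, the map (x,y) ↦ c_{x,y} from GF(2^m) × GF(2^s) to 𝔽_2^{D_{f_λ}} is injective (so C_{D_{f_λ}} is an 𝔽_2-linear subspace of dimension m+s), and every nonzero codeword of C_{D_{f_λ}} has Hamming weight at least nl(F) − (2^m − n_{f_λ})/2. -/
open Finset
noncomputable section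
open scoped Classical

/-- `GF n` is the finite field with `2^n` elements. -/
abbrev GF (n : ℕ) : Type := GaloisField 2 n

noncomputable instance (n : ℕ) : Fintype (GF n) := Fintype.ofFinite _

/-- The absolute trace map `GF n → 𝔽₂`. -/
def tr {n : ℕ} (x : GF n) : ZMod 2 := Algebra.trace (ZMod 2) (GF n) x

/-- The Walsh transform of an `(m,s)`-function `F` at `(α, β)`. -/
def walshF {m s : ℕ} (F : GF m → GF s) (α : GF s) (β : GF m) : ℤ :=
  ∑ x : GF m, (-1 : ℤ) ^ (tr (α * F x) + tr (β * x)).val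

/-- `max_{(α,β), α ≠ 0} |Ŵ_F(α,β)|`. -/
def maxW {m s : ℕ} (F : GF m → GF s) : ℕ :=
  Finset.sup (univ.filter (fun p : GF s × GF m => p.1 ≠ 0))
    (fun p => (walshF F p.1 p.2).natAbs)

/-- The nonlinearity `nl(F) = 2^(m-1) - (1/2)·max |Ŵ_F|`, as a rational number. -/
def nlF {m s : ℕ} (F : GF m → GF s) : ℚ := (2:ℚ)^m / 2 - (maxW F : ℚ) / 2

/-- The support `D_{f_λ}` of the component function `f_λ = Tr(λ·F)`. -/
abbrev Dsupp {m s : ℕ} (F : GF m → GF s) (lam : GF s) : Type :=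
  {d : GF m // tr (lam * F d) = 1}

/-- `n_{f_λ}`, the cardinality of the support of `f_λ`. -/
def nSupp {m s : ℕ} (F : GF m → GF s) (lam : GF s) : ℕ := Fintype.card (Dsupp F lam)

/-- The codeword `c_{x,y} = (Tr(x·d) + Tr(y·F(d)))_{d ∈ D_{f_λ}}`. -/
def cw {m s : ℕ} (F : GF m → GF s) (lam : GF s) (x : GF m) (y : GF s) :
    Dsupp F lam → ZMod 2 :=
  fun d => tr (x * d.1) + tr (y * F d.1)

/-- Hamming weight of the codeword `c_{x,y}`. -/
def wtc {m s : ℕ} (F : GF m → GF s) (lam : GF s) (x : GF m) (y : GF s) : ℕ :=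
  (univ.filter (fun d : Dsupp F lam => cw F lam x y d ≠ 0)).card

theorem tr_add {n : ℕ} (a b : GF n) : tr (a + b) = tr a + tr b :=
  map_add (Algebra.trace (ZMod 2) (GF n)) a b

theorem tr_zero {n : ℕ} : tr (0 : GF n) = 0 :=
  map_zero (Algebra.trace (ZMod 2) (GF n))

theorem exists_tr_mul_eq_one {n : ℕ} {x : GF n} (hx : x ≠ 0) : ∃ c : GF n, tr (x * c) = 1 := by
  obtain ⟨a, ha⟩ := Algebra.trace_surjective (ZMod 2) (GF n) 1
  exact ⟨x⁻¹ * a, by rw [mul_inv_cancel_left₀ hx]; exact ha⟩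

theorem walshF_zero_left {m s : ℕ} (F : GF m → GF s) {x : GF m} (hx : x ≠ 0) :
    walshF F 0 x = 0 := by
  obtain ⟨c, hc⟩ := exists_tr_mul_eq_one hx
  have hneg : walshF F 0 x = -walshF F 0 x := by
    unfold walshF
    rw [← Finset.sum_neg_distrib, ← Equiv.sum_comp (Equiv.addRight c)]
    refine Finset.sum_congr rfl fun d _ => ?_
    simp only [Equiv.coe_addRight, zero_mul, tr_zero, zero_add, mul_add, tr_add, hc]
    generalize tr (x * d) = u
    revert u
    decide
  omega

theorem walshF_zero_left_nonneg {m s : ℕ} (F : GF m → GF s) (x : GF m) :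
    0 ≤ walshF F 0 x := by
  by_cases hx : x = 0
  · subst hx
    simp [walshF, tr_zero]
  · exact (walshF_zero_left F hx).ge

theorem abs_walshF_le {m s : ℕ} (F : GF m → GF s) {α : GF s} (hα : α ≠ 0) (β : GF m) :
    |walshF F α β| ≤ maxW F := by
  have h : (walshF F α β).natAbs ≤ maxW F :=
    Finset.le_sup (s := univ.filter (fun p : GF s × GF m => p.1 ≠ 0))
      (f := fun p => (walshF F p.1 p.2).natAbs) (b := (α, β)) (by simpa using hα)
  rw [Int.abs_eq_natAbs]
  exact_mod_cast h

theorem nSupp_eq_sum {m s : ℕ} (F : GF m → GF s) (lam : GF s) :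
    (nSupp F lam : ℤ) = ∑ d : GF m, if tr (lam * F d) = 1 then 1 else 0 := by
  rw [nSupp, Fintype.card_subtype, Finset.sum_boole]

theorem wtc_eq_sum {m s : ℕ} (F : GF m → GF s) (lam : GF s) (x : GF m) (y : GF s) :
    (wtc F lam x y : ℤ) =
      ∑ d : GF m, if tr (lam * F d) = 1 ∧ tr (y * F d) + tr (x * d) ≠ 0 then 1 else 0 := by
  rw [wtc, Finset.sum_boole]
  norm_cast
  refine Finset.card_bij (fun d _ => d.1) ?_ ?_ ?_
  · intro d hd
    have hd' := (mem_filter.mp hd).2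
    exact mem_filter.mpr ⟨mem_univ _, d.2, by simpa [cw, add_comm] using hd'⟩
  · intro a _ b _ h
    exact Subtype.ext h
  · intro d hd
    simp only [mem_filter, mem_univ, true_and] at hd
    exact ⟨⟨d, hd.1⟩, mem_filter.mpr ⟨mem_univ _, by simpa [cw, add_comm] using hd.2⟩, rfl⟩

theorem two_mul_nSupp_sub_wtc {m s : ℕ} (F : GF m → GF s) (lam : GF s) (x : GF m) (y : GF s) :
    2 * ((nSupp F lam : ℤ) - 2 * wtc F lam x y) = walshF F y x - walshF F (y + lam) x := by
  rw [nSupp_eq_sum, wtc_eq_sum, walshF, walshF, Finset.mul_sum, ← Finset.sum_sub_distrib,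
    ← Finset.sum_sub_distrib, Finset.mul_sum]
  refine Finset.sum_congr rfl fun d _ => ?_
  rw [add_mul, tr_add]
  generalize tr (lam * F d) = v
  generalize tr (y * F d) = u
  generalize tr (x * d) = w
  fin_cases u <;> fin_cases v <;> fin_cases w <;> simp +decide

theorem nSupp_le_two_mul_wtc_add_maxW {m s : ℕ} (F : GF m → GF s) (lam : GF s)
    {x : GF m} {y : GF s} (hxy : x ≠ 0 ∨ y ≠ 0) :
    (nSupp F lam : ℤ) ≤ 2 * wtc F lam x y + maxW F := by
  have key := two_mul_nSupp_sub_wtc F lam x y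
  have hleft : walshF F y x ≤ maxW F := by
    by_cases hy : y = 0
    · subst hy
      rw [walshF_zero_left F (hxy.resolve_right (by simp))]
      positivity
    · exact (le_abs_self _).trans (abs_walshF_le F hy x)
  have hright : -walshF F (y + lam) x ≤ maxW F := by
    by_cases hy : y + lam = 0
    · rw [hy]
      linarith [walshF_zero_left_nonneg F x, Int.natCast_nonneg (maxW F)]
    · exact (neg_le_abs _).trans (abs_walshF_le F hy x)
  linarith

theorem cw_sub {m s : ℕ} (F : GF m → GF s) (lam : GF s) (x x' : GF m) (y y' : GF s) :
    cw F lam (x - x') (y - y') = cw F lam x y - cw F lam x' y' := by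
  have tr_sub : ∀ {n : ℕ} (a b : GF n), tr (a - b) = tr a - tr b := fun a b =>
    map_sub (Algebra.trace (ZMod 2) _) a b
  funext d
  simp only [cw, Pi.sub_apply, sub_mul, tr_sub]
  ring

/-- if `2^m - 2·nl(F) < n_{f_λ}` then the code `C_{D_{f_λ}}` (of length
`n_{f_λ}`) is given by an injective map `(x,y) ↦ c_{x,y}` (hence is an `𝔽₂`-subspace of
dimension `m+s`), and every nonzero codeword has weight at least
`nl(F) - (2^m - n_{f_λ})/2`. -/
theorem stmt0 (m s : ℕ) (hm : 1 ≤ m) (hs : 1 ≤ s)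
    (F : GF m → GF s) (lam : GF s) (hlam : lam ≠ 0)
    (hcond : (2:ℚ)^m - 2 * nlF F < (nSupp F lam : ℚ)) :
    Function.Injective (fun p : GF m × GF s => cw F lam p.1 p.2) ∧
    ∀ x : GF m, ∀ y : GF s, cw F lam x y ≠ 0 →
      nlF F - ((2:ℚ)^m - (nSupp F lam : ℚ)) / 2 ≤ (wtc F lam x y : ℚ) := by
  have two_mul_nlF : 2 * nlF F = (2:ℚ)^m - maxW F := by unfold nlF; ring
  have hlt : (maxW F : ℤ) < nSupp F lam := by
    have : (maxW F : ℚ) < nSupp F lam := by linarith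
    exact_mod_cast this
  refine ⟨?_, ?_⟩
  · rintro ⟨x, y⟩ ⟨x', y'⟩ h
    by_contra hne
    have hxy : x - x' ≠ 0 ∨ y - y' ≠ 0 := by
      by_contra! hc
      exact hne (Prod.ext (sub_eq_zero.mp hc.1) (sub_eq_zero.mp hc.2))
    have hzero : cw F lam (x - x') (y - y') = 0 := by
      rw [cw_sub]
      exact sub_eq_zero.mpr h
    have hwt : wtc F lam (x - x') (y - y') = 0 := by simp [wtc, hzero]
    have hle := nSupp_le_two_mul_wtc_add_maxW F lam hxy
    rw [hwt] at hle
    push_cast at hle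
    linarith
  · intro x y h
    have hxy : x ≠ 0 ∨ y ≠ 0 := by
      by_contra! hc
      refine h (funext fun d => ?_)
      simp [cw, hc.1, hc.2, tr_zero]
    have hle : (nSupp F lam : ℚ) ≤ 2 * wtc F lam x y + maxW F := by
      exact_mod_cast nSupp_le_two_mul_wtc_add_maxW F lam hxy
    linarith
end
end

section
/- Let m ≥ 5 be odd, let i satisfy gcd(i,m) = 1 and 1 ≤ i ≤ (m−1)/2, set e = 2^i + 1, and suppose F(x) = x^e is almost bent on GF(2^m). Let λ, μ be two distinct elements of GF(2^m)\{0}. Let D = {d ∈ GF(2^m) : Tr^m((λ+μ)·d^e) = 1} and for x ∈ GF(2^m) let s_x ∈ 𝔽_2^D be the vector s_x = (Tr^m(x·d + λ·d^e))_{d ∈ D}. Then for every x ∈ GF(2^m) the Hamming weight wt(s_x) lies in {2^{m−2} − 2^{(m−1)/2}, 2^{m−2} − 2^{(m−3)/2}, 2^{m−2}, 2^{m−2} + 2^{(m−3)/2}, 2^{m−2} + 2^{(m−1)/2}}, and the number of x ∈ GF(2^m) with wt(s_x) = w equals: for w = 2^{m−2} − 2^{(m−1)/2}: 2^{m−4}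 + 2^{(m−5)/2}·(Tr(λ/μ) − Tr(μ/λ)); for w = 2^{m−2} − 2^{(m−3)/2}: 2^{m−2} + 2^{(m−3)/2}·(Tr(μ/λ) − Tr(λ/μ)); for w = 2^{m−2}: 3·2^{m−3}; for w = 2^{m−2} + 2^{(m−3)/2}: 2^{m−2} + 2^{(m−3)/2}·(Tr(λ/μ) − Tr(μ/λ)); for w = 2^{m−2} + 2^{(m−1)/2}: 2^{m−4} + 2^{(m−5)/2}·(Tr(μ/λ) − Tr(λ/μ)); where Tr(λ/μ), Tr(μ/λ) ∈ {0,1} denote the integer values of Tr^m(λ·μ^{−1}) and Tr^m(μ·λ^{−1}). -/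
open Finset
noncomputable section
open scoped Classical

/-- The support `D = {d : Tr((λ+μ)·d^e) = 1}`. -/
abbrev DsetS {m : ℕ} (e : ℕ) (c : GF m) : Type := {d : GF m // tr (c * d ^ e) = 1}

/-- The vector `s_x = (Tr(x·d + λ·d^e))_{d ∈ D}`. -/
def sVec {m : ℕ} (e : ℕ) (c lam : GF m) (x : GF m) : DsetS e c → ZMod 2 :=
  fun d => tr (x * d.1 + lam * d.1 ^ e)

/-- The Hamming weight of `s_x`. -/
def wtS {m : ℕ} (e : ℕ) (c lam : GF m) (x : GF m) : ℕ :=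
  (univ.filter (fun d : DsetS e c => sVec e c lam x d ≠ 0)).card

/-- The number of `x` with `wt(s_x) = w`. -/
def cntS {m : ℕ} (e : ℕ) (c lam : GF m) (w : ℕ) : ℕ :=
  (univ.filter (fun x : GF m => wtS e c lam x = w)).card

/-- The quadratic additive character `x ↦ (-1)^{Tr x}` of `GF m`. -/
def chi {m : ℕ} (x : GF m) : ℤ := (-1) ^ (tr x).val

/-- The Walsh coefficient at `x` of the power function `d ↦ ρ d^e`. -/
def powWalsh {m : ℕ} (e : ℕ) (ρ x : GF m) : ℤ := ∑ d : GF m, chi (ρ * d ^ e + x * d)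

theorem neg_one_pow_val_add (a b : ZMod 2) :
    (-1 : ℤ) ^ (a + b).val = (-1) ^ a.val * (-1) ^ b.val := by
  revert a b; decide

theorem one_sub_neg_one_pow_val (a : ZMod 2) :
    1 - (-1 : ℤ) ^ a.val = 2 * a.val := by
  revert a; decide

theorem tr_add_s13 {m : ℕ} (x y : GF m) : tr (x + y) = tr x + tr y :=
  map_add (Algebra.trace (ZMod 2) (GF m)) x y

theorem chi_add {m : ℕ} (x y : GF m) : chi (x + y) = chi x * chi y := by
  rw [chi, tr_add_s13, neg_one_pow_val_add]; rfl

theorem chi_zero {m : ℕ} : chi (0 : GF m) = 1 := by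
  simp [chi, tr]

theorem one_sub_chi {m : ℕ} (x : GF m) : 1 - chi x = 2 * (tr x).val :=
  one_sub_neg_one_pow_val _

theorem chi_eq_one_or {m : ℕ} (x : GF m) : chi x = 1 ∨ chi x = -1 :=
  neg_one_pow_eq_or ℤ _

theorem tr_sq {m : ℕ} (x : GF m) : tr (x ^ 2) = tr x := by
  have h := Algebra.trace_eq_of_algEquiv (FiniteField.frobeniusAlgEquivOfAlgebraic (ZMod 2) (GF m)) x
  rw [FiniteField.coe_frobeniusAlgEquivOfAlgebraic, ZMod.card] at h
  exact h

theorem tr_pow_two_pow {m : ℕ} (j : ℕ) (x : GF m) : tr (x ^ 2 ^ j) = tr x := by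
  induction j with
  | zero => simp
  | succ j ih => rw [pow_succ, pow_mul, tr_sq, ih]

theorem chi_pow_two_pow {m : ℕ} (j : ℕ) (x : GF m) : chi (x ^ 2 ^ j) = chi x := by
  rw [chi, tr_pow_two_pow, chi]

theorem chi_one {m : ℕ} (hm : Odd m) : chi (1 : GF m) = -1 := by
  have h : tr (1 : GF m) = 1 := by
    have h1 := Algebra.trace_algebraMap (R := ZMod 2) (S := GF m) 1
    rw [map_one, GaloisField.finrank 2 hm.pos.ne'] at h1
    rw [tr, h1, nsmul_one]
    exact ZMod.natCast_eq_one_iff_odd.2 hm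
  rw [chi, h]; rfl

theorem card_GF {m : ℕ} (hm : m ≠ 0) : Fintype.card (GF m) = 2 ^ m := by
  rw [← Nat.card_eq_fintype_card, GaloisField.card 2 m hm]

theorem exists_tr_mul_eq_one_s13 {m : ℕ} {a : GF m} (ha : a ≠ 0) : ∃ b, tr (a * b) = 1 := by
  obtain ⟨y, hy⟩ := Algebra.trace_surjective (ZMod 2) (GF m) 1
  exact ⟨a⁻¹ * y, by rw [mul_inv_cancel_left₀ ha]; exact hy⟩

theorem sum_chi_mul {m : ℕ} (hm : m ≠ 0) (a : GF m) :
    ∑ x : GF m, chi (x * a) = if a = 0 then 2 ^ m else 0 := by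
  split_ifs with ha
  · simp [ha, chi_zero, card_GF hm]
  · obtain ⟨b, hb⟩ := exists_tr_mul_eq_one_s13 ha
    have hb' : chi (b * a) = -1 := by rw [mul_comm, chi, hb]; rfl
    have h := Fintype.sum_equiv (Equiv.addRight b) (fun x : GF m => chi ((x + b) * a))
      (fun x => chi (x * a)) (fun x => rfl)
    simp only [add_mul, chi_add, ← Finset.sum_mul, hb'] at h
    linarith

theorem add_eq_zero_iff_eq_GF {m : ℕ} {a b : GF m} : a + b = 0 ↔ a = b := by
  rw [← CharTwo.sub_eq_add, sub_eq_zero]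

/-- The fixed field of `x ↦ x^{2^j}` on `GF m` is `𝔽₂` when `j` and `m` are coprime. -/
theorem eq_zero_or_one_of_pow_two_pow {m j : ℕ} (hm : m ≠ 0) (hj : Nat.gcd j m = 1) {u : GF m}
    (hu : u ^ 2 ^ j = u) : u = 0 ∨ u = 1 := by
  have h1 : Function.IsPeriodicPt (frobenius (GF m) 2) j u := by
    rw [Function.IsPeriodicPt, Function.IsFixedPt, iterate_frobenius, hu]
  have h2 : Function.IsPeriodicPt (frobenius (GF m) 2) m u := by
    rw [Function.IsPeriodicPt, Function.IsFixedPt, iterate_frobenius, ← card_GF hm,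
      FiniteField.pow_card]
  have h3 := h1.gcd h2
  rw [hj, Function.IsPeriodicPt, Function.IsFixedPt, iterate_frobenius, pow_one] at h3
  have h4 : u * (u - 1) = 0 := by linear_combination h3
  rcases mul_eq_zero.1 h4 with h | h
  · exact Or.inl h
  · exact Or.inr (sub_eq_zero.1 h)

theorem gold_bijective {m i : ℕ} (hm : m ≠ 0) (hi : Nat.gcd (2 * i) m = 1) :
    Function.Bijective (fun x : GF m => x ^ (2 ^ i + 1)) := by
  refine Finite.injective_iff_bijective.1 fun x y hxy => ?_
  change x ^ (2 ^ i + 1) = y ^ (2 ^ i + 1) at hxy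
  rcases eq_or_ne y 0 with rfl | hy
  · simpa using hxy
  have ht : (x / y) ^ (2 ^ i + 1) = 1 := by
    rw [div_pow, hxy, div_self (pow_ne_zero _ hy)]
  set t := x / y
  have h1 : t ^ 2 ^ i * t = 1 := by rw [← pow_succ, ht]
  have h2 : t ^ 2 ^ (2 * i) * t ^ 2 ^ i = 1 := by
    rw [two_mul, pow_add 2 i i, pow_mul, ← mul_pow, h1, one_pow]
  have h3 : t ^ 2 ^ (2 * i) = t := by
    linear_combination t * h2 - t ^ 2 ^ (2 * i) * h1
  rcases eq_zero_or_one_of_pow_two_pow hm hi h3 with h | h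
  · rw [h] at h1; simp at h1
  · rw [div_eq_one_iff_eq hy] at h; exact h

theorem sum_chi_mul_gold {m i : ℕ} (hm : m ≠ 0) (hi : Nat.gcd (2 * i) m = 1) {c : GF m}
    (hc : c ≠ 0) : ∑ d : GF m, chi (c * d ^ (2 ^ i + 1)) = 0 := by
  have h := Fintype.sum_bijective _ (gold_bijective hm hi)
    (fun d : GF m => chi (c * d ^ (2 ^ i + 1))) (fun y => chi (y * c))
    (fun x => by simp only [mul_comm])
  rw [h, sum_chi_mul hm, if_neg hc]

/-- Polarisation of the Gold function. -/
theorem gold_add {m : ℕ} (i : ℕ) (y d u : GF m) :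
    (d ^ (2 ^ i + 1) + y * d) + ((d + u) ^ (2 ^ i + 1) + y * (d + u))
      = (u ^ (2 ^ i + 1) + y * u) + (d ^ 2 ^ i * u + d * u ^ 2 ^ i) := by
  rw [pow_succ (d + u), add_pow_char_pow]
  have h2 : (2 : GF m) = 0 := CharTwo.two_eq_zero
  linear_combination (d ^ (2 ^ i + 1) + y * d) * h2

theorem sum_chi_gold_polar {m i : ℕ} (hm : m ≠ 0) (hi : Nat.gcd (2 * i) m = 1) (u : GF m) :
    ∑ d : GF m, chi (d ^ 2 ^ i * u + d * u ^ 2 ^ i) = if u = 0 ∨ u = 1 then 2 ^ m else 0 := by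
  have hsurj : Function.Surjective (iterateFrobenius (GF m) 2 i) :=
    Finite.surjective_of_injective (RingHom.injective _)
  obtain ⟨v, hv⟩ := hsurj u
  rw [iterateFrobenius_def] at hv
  have h : ∀ d : GF m, chi (d ^ 2 ^ i * u + d * u ^ 2 ^ i) = chi (d * (v + u ^ 2 ^ i)) := by
    intro d
    rw [chi_add, mul_add, chi_add, ← hv, ← mul_pow, chi_pow_two_pow]
  simp only [h, sum_chi_mul hm]
  refine if_congr ?_ rfl rfl
  rw [add_eq_zero_iff_eq_GF]
  constructor
  · intro hvu
    refine eq_zero_or_one_of_pow_two_pow hm hi ?_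
    rw [two_mul, pow_add, pow_mul, ← hvu, hv]
  · intro hu
    refine RingHom.injective (iterateFrobenius (GF m) 2 i) ?_
    rw [iterateFrobenius_def, iterateFrobenius_def, hv]
    rcases hu with rfl | rfl <;> simp

theorem powWalsh_one_sq {m i : ℕ} (hm : Odd m) (hi : Nat.gcd (2 * i) m = 1) (y : GF m) :
    powWalsh (2 ^ i + 1) 1 y ^ 2 = 2 ^ m * (1 - chi y) := by
  have h1 : powWalsh (2 ^ i + 1) 1 y ^ 2 = ∑ u : GF m, chi (u ^ (2 ^ i + 1) + y * u) *
      ∑ d : GF m, chi (d ^ 2 ^ i * u + d * u ^ 2 ^ i) := by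
    simp only [powWalsh, one_mul, sq]
    rw [Finset.sum_mul]
    simp only [Finset.mul_sum]
    rw [Finset.sum_comm (γ := GF m) (s := univ) (t := univ)
      (f := fun u d => chi (u ^ (2 ^ i + 1) + y * u) * chi (d ^ 2 ^ i * u + d * u ^ 2 ^ i))]
    refine Finset.sum_congr rfl fun d _ => ?_
    rw [← Fintype.sum_equiv (Equiv.addLeft d)
      (fun u => chi (d ^ (2 ^ i + 1) + y * d) * chi ((d + u) ^ (2 ^ i + 1) + y * (d + u))) _
      (fun u => rfl)]
    refine Finset.sum_congr rfl fun u _ => ?_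
    rw [← chi_add, ← chi_add, gold_add]
  rw [h1]
  simp only [sum_chi_gold_polar hm.pos.ne' hi, mul_ite, mul_zero]
  rw [← Finset.sum_filter]
  have h2 : (univ.filter fun u : GF m => u = 0 ∨ u = 1) = {0, 1} := by ext; simp
  rw [h2, Finset.sum_pair zero_ne_one]
  simp only [one_pow, chi_add, mul_one, chi_one hm, mul_zero, chi_zero,
    zero_pow (Nat.succ_ne_zero _)]
  ring

theorem powWalsh_eq_of_mul_pow_eq_one {m e : ℕ} {ρ r : GF m} (hr : r ≠ 0) (h : ρ * r ^ e = 1)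
    (x : GF m) : powWalsh e ρ x = powWalsh e 1 (x * r) := by
  refine (Fintype.sum_equiv (Equiv.mulLeft₀ r hr) _ _ fun d => ?_).symm
  simp only [Equiv.mulLeft₀, Units.mulLeft_apply, Units.val_mk0, mul_pow]
  rw [← mul_assoc ρ, h, mul_assoc]

/-- Fourier inversion for `powWalsh`. -/
theorem sum_chi_mul_powWalsh {m e : ℕ} (hm : m ≠ 0) (ρ z : GF m) :
    ∑ x : GF m, chi (x * z) * powWalsh e ρ x = 2 ^ m * chi (ρ * z ^ e) := by
  have h : ∀ x d : GF m, chi (x * z) * chi (ρ * d ^ e + x * d)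
      = chi (ρ * d ^ e) * chi (x * (z + d)) := by
    intro x d
    rw [chi_add, mul_add, chi_add]; ring
  simp only [powWalsh, Finset.mul_sum, h]
  rw [Finset.sum_comm]
  simp only [← Finset.mul_sum, sum_chi_mul hm, add_eq_zero_iff_eq_GF, mul_ite, mul_zero,
    Finset.sum_ite_eq, Finset.mem_univ, if_true]
  ring

/-- Parseval's identity for `powWalsh`. -/
theorem sum_powWalsh_mul_powWalsh {m e : ℕ} (hm : m ≠ 0) (ρ σ : GF m) :
    ∑ x : GF m, powWalsh e ρ x * powWalsh e σ x = 2 ^ m * ∑ d : GF m, chi ((ρ + σ) * d ^ e) := by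
  have h : ∀ x : GF m, powWalsh e ρ x * powWalsh e σ x
      = ∑ d : GF m, chi (σ * d ^ e) * (chi (x * d) * powWalsh e ρ x) := by
    intro x
    conv_lhs => rw [powWalsh.eq_def e σ, Finset.mul_sum]
    refine Finset.sum_congr rfl fun d _ => ?_
    rw [chi_add]; ring
  simp only [h]
  rw [Finset.sum_comm]
  simp only [← Finset.mul_sum, sum_chi_mul_powWalsh hm]
  rw [Finset.mul_sum]
  refine Finset.sum_congr rfl fun d _ => ?_
  rw [add_mul, chi_add]; ring

theorem four_mul_wtS {m e : ℕ} (hm : m ≠ 0) {lam mu : GF m}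
    (hc : ∑ d : GF m, chi ((lam + mu) * d ^ e) = 0) (x : GF m) :
    4 * (wtS e (lam + mu) lam x : ℤ) = 2 ^ m + powWalsh e mu x - powWalsh e lam x := by
  have h1 : wtS e (lam + mu) lam x = (univ.filter fun d : GF m =>
      tr ((lam + mu) * d ^ e) = 1 ∧ tr (x * d + lam * d ^ e) ≠ 0).card := by
    refine Finset.card_bij (fun d _ => d.1) ?_ ?_ ?_
    · intro d hd
      exact Finset.mem_filter.2 ⟨Finset.mem_univ _, d.2, (Finset.mem_filter.1 hd).2⟩
    · intro a _ b _ hab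
      exact Subtype.ext hab
    · intro d hd
      simp only [Finset.mem_filter, Finset.mem_univ, true_and] at hd
      exact ⟨⟨d, hd.1⟩, Finset.mem_filter.2 ⟨Finset.mem_univ _, hd.2⟩, rfl⟩
  have h2 : ∀ a b : ZMod 2, (4 : ℤ) * (if a = 1 ∧ b ≠ 0 then 1 else 0)
      = (1 - (-1) ^ a.val) * (1 - (-1) ^ b.val) := by decide
  have h3 : ∀ d : GF m, (4 : ℤ) *
      (if tr ((lam + mu) * d ^ e) = 1 ∧ tr (x * d + lam * d ^ e) ≠ 0 then 1 else 0)
      = 1 - chi ((lam + mu) * d ^ e) - chi (lam * d ^ e + x * d) + chi (mu * d ^ e + x * d) := by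
    intro d
    have h4 : chi (mu * d ^ e + x * d)
        = chi ((lam + mu) * d ^ e) * chi (lam * d ^ e + x * d) := by
      rw [← chi_add]
      congr 1
      have h2 : (2 : GF m) = 0 := CharTwo.two_eq_zero
      linear_combination (-lam * d ^ e) * h2
    rw [h4, h2, add_comm (x * d)]
    change (1 - chi _) * (1 - chi _) = _
    ring
  rw [h1, Finset.card_filter]
  push_cast
  rw [Finset.mul_sum]
  simp only [h3, Finset.sum_add_distrib, Finset.sum_sub_distrib, hc, powWalsh]
  simp [card_GF hm]
  ring

/-- A difference of two `{-1, 0, 1}`-valued functions has a value distribution determined by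
the joint moments of the two functions. -/
theorem card_filter_sub_eq {α : Type*} [Fintype α] (a b : α → ℤ)
    (ha : ∀ x, a x = 0 ∨ a x = 1 ∨ a x = -1) (hb : ∀ x, b x = 0 ∨ b x = 1 ∨ b x = -1)
    {A B A2 B2 P Q R S : ℤ} (hA : ∑ x, a x = A) (hB : ∑ x, b x = B)
    (hA2 : ∑ x, a x ^ 2 = A2) (hB2 : ∑ x, b x ^ 2 = B2) (hP : ∑ x, a x * b x = P)
    (hQ : ∑ x, a x ^ 2 * b x = Q) (hR : ∑ x, a x * b x ^ 2 = R)
    (hS : ∑ x, a x ^ 2 * b x ^ 2 = S) :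
    4 * ((univ.filter fun x => b x - a x = -2).card : ℤ) = S - Q + R - P ∧
    2 * ((univ.filter fun x => b x - a x = -1).card : ℤ) = A2 + A + B2 - B - 2 * S - R + Q ∧
    2 * ((univ.filter fun x => b x - a x = 0).card : ℤ)
      = 2 * Fintype.card α - 2 * A2 - 2 * B2 + 3 * S + P ∧
    2 * ((univ.filter fun x => b x - a x = 1).card : ℤ) = A2 - A + B2 + B - 2 * S + R - Q ∧
    4 * ((univ.filter fun x => b x - a x = 2).card : ℤ) = S + Q - R - P := by
  subst hA hB hA2 hB2 hP hQ hR hS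
  have hcard : (Fintype.card α : ℤ) = ∑ _x : α, 1 := by simp
  rw [hcard]
  simp only [Finset.card_filter]
  push_cast
  simp only [Finset.mul_sum, ← Finset.sum_add_distrib, ← Finset.sum_sub_distrib]
  refine ⟨?_, ?_, ?_, ?_, ?_⟩ <;> refine Finset.sum_congr rfl fun x _ => ?_ <;>
    rcases ha x with h | h | h <;> rcases hb x with h' | h' | h' <;> rw [h, h'] <;> norm_num

/-- The Walsh coefficients of a Gold function are `0` or `±2^{k+1}`, with an explicit support. -/
theorem exists_sign_of_powWalsh {k i : ℕ} (hi : Nat.gcd (2 * i) (2 * k + 1) = 1)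
    {ρ r : GF (2 * k + 1)} (hr : r ≠ 0) (h : ρ * r ^ (2 ^ i + 1) = 1) (x : GF (2 * k + 1)) :
    ∃ a : ℤ, powWalsh (2 ^ i + 1) ρ x = 2 ^ (k + 1) * a ∧ (a = 0 ∨ a = 1 ∨ a = -1) ∧
      2 * a ^ 2 = 1 - chi (x * r) := by
  have hsq := powWalsh_one_sq ⟨k, rfl⟩ hi (x * r)
  rw [← powWalsh_eq_of_mul_pow_eq_one hr h] at hsq
  rcases chi_eq_one_or (x * r) with hx | hx
  · refine ⟨0, ?_, Or.inl rfl, by rw [hx]; norm_num⟩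
    rw [hx, sub_self, mul_zero] at hsq
    rw [mul_zero]; exact pow_eq_zero_iff two_ne_zero |>.1 hsq
  · have h2 : powWalsh (2 ^ i + 1) ρ x ^ 2 = (2 ^ (k + 1)) ^ 2 := by
      rw [hsq, hx]; ring
    rcases sq_eq_sq_iff_eq_or_eq_neg.1 h2 with h3 | h3
    · exact ⟨1, by rw [h3, mul_one], by simp, by rw [hx]; norm_num⟩
    · exact ⟨-1, by rw [h3, mul_neg_one], by simp, by rw [hx]; norm_num⟩

/-- the weight distribution of the vectors `s_x` associated with a Gold
almost bent function `F(x) = x^e`, `e = 2^i + 1`, on `GF(2^m)`, `m = 2k+1 ≥ 5` odd,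
and two distinct `λ, μ ∈ GF(2^m)*`. -/
theorem stmt13 (m k i : ℕ) (hm : m = 2 * k + 1) (hm5 : 5 ≤ m)
    (hi : Nat.gcd i m = 1) (hi1 : 1 ≤ i) (hik : i ≤ k)
    (e : ℕ) (he : e = 2 ^ i + 1)
    (F : GF m → GF m) (hF : ∀ x : GF m, F x = x ^ e)
    (hAB : ∀ ρ : GF m, ρ ≠ 0 → ∀ a : GF m,
      walshF F ρ a ∈ ({0, 2 ^ (k + 1), -(2 ^ (k + 1))} : Set ℤ))
    (lam mu : GF m) (hlam : lam ≠ 0) (hmu : mu ≠ 0) (hne : lam ≠ mu) :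
    (∀ x : GF m, wtS e (lam + mu) lam x ∈
      ({2 ^ (m - 2) - 2 ^ k, 2 ^ (m - 2) - 2 ^ (k - 1), 2 ^ (m - 2),
        2 ^ (m - 2) + 2 ^ (k - 1), 2 ^ (m - 2) + 2 ^ k} : Set ℕ)) ∧
    (cntS e (lam + mu) lam (2 ^ (m - 2) - 2 ^ k) : ℤ)
      = 2 ^ (m - 4) + 2 ^ (k - 2) *
          (((tr (lam * mu⁻¹)).val : ℤ) - ((tr (mu * lam⁻¹)).val : ℤ)) ∧
    (cntS e (lam + mu) lam (2 ^ (m - 2) - 2 ^ (k - 1)) : ℤ)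
      = 2 ^ (m - 2) + 2 ^ (k - 1) *
          (((tr (mu * lam⁻¹)).val : ℤ) - ((tr (lam * mu⁻¹)).val : ℤ)) ∧
    (cntS e (lam + mu) lam (2 ^ (m - 2)) : ℤ) = 3 * 2 ^ (m - 3) ∧
    (cntS e (lam + mu) lam (2 ^ (m - 2) + 2 ^ (k - 1)) : ℤ)
      = 2 ^ (m - 2) + 2 ^ (k - 1) *
          (((tr (lam * mu⁻¹)).val : ℤ) - ((tr (mu * lam⁻¹)).val : ℤ)) ∧
    (cntS e (lam + mu) lam (2 ^ (m - 2) + 2 ^ k) : ℤ)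
      = 2 ^ (m - 4) + 2 ^ (k - 2) *
          (((tr (mu * lam⁻¹)).val : ℤ) - ((tr (lam * mu⁻¹)).val : ℤ)) := by
  subst hm he
  obtain ⟨t, rfl⟩ : ∃ t, k = t + 2 := ⟨k - 2, by omega⟩
  have hi2 : Nat.gcd (2 * i) (2 * (t + 2) + 1) = 1 :=
    Nat.Coprime.mul_left ((Nat.coprime_two_left).2 ⟨t + 2, rfl⟩) hi
  have hm0 : 2 * (t + 2) + 1 ≠ 0 := by omega
  have he0 : 2 ^ i + 1 ≠ 0 := Nat.succ_ne_zero _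
  have hc0 : lam + mu ≠ 0 := fun h => hne (add_eq_zero_iff_eq_GF.1 h)
  have hc := sum_chi_mul_gold hm0 hi2 hc0
  obtain ⟨r, hr⟩ := (gold_bijective hm0 hi2).2 lam⁻¹
  obtain ⟨s, hs⟩ := (gold_bijective hm0 hi2).2 mu⁻¹
  change r ^ (2 ^ i + 1) = _ at hr
  change s ^ (2 ^ i + 1) = _ at hs
  have hr0 : r ≠ 0 := by
    rintro rfl
    rw [zero_pow he0] at hr
    exact inv_ne_zero hlam hr.symm
  have hs0 : s ≠ 0 := by
    rintro rfl
    rw [zero_pow he0] at hs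
    exact inv_ne_zero hmu hs.symm
  have hrs : r + s ≠ 0 := by
    intro h
    rw [add_eq_zero_iff_eq_GF.1 h, hs] at hr
    exact hne (inv_injective hr).symm
  choose a hWa ha hchia using
    exists_sign_of_powWalsh hi2 hr0 (by rw [hr, mul_inv_cancel₀ hlam] : lam * _ = 1)
  choose b hWb hb hchib using
    exists_sign_of_powWalsh hi2 hs0 (by rw [hs, mul_inv_cancel₀ hmu] : mu * _ = 1)
  obtain ⟨T, hT⟩ : ∃ T : ℤ, T = 2 ^ t := ⟨_, rfl⟩
  have hT0 : 0 < T := hT ▸ by positivity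
  have hk1 : (2 : ℤ) ^ (t + 2 + 1) = 8 * T := by rw [hT]; ring
  have hmT : (2 : ℤ) ^ (2 * (t + 2) + 1) = 32 * T ^ 2 := by rw [hT]; ring
  simp only [hk1] at hWa hWb
  have hsum : ∀ z : GF (2 * (t + 2) + 1), z ≠ 0 → ∑ x, chi (x * z) = 0 := fun z hz => by
    rw [sum_chi_mul hm0, if_neg hz]
  have hone : ∑ _x : GF (2 * (t + 2) + 1), (1 : ℤ) = 32 * T ^ 2 := by
    rw [← hmT]; simp [card_GF hm0]
  have h8 : 8 * T ≠ 0 := by positivity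
  have hfa : ∀ z, ∑ x, chi (x * z) * a x = 4 * T * chi (lam * z ^ (2 ^ i + 1)) := fun z => by
    have h := sum_chi_mul_powWalsh (e := 2 ^ i + 1) hm0 lam z
    simp only [hWa, mul_left_comm _ (8 * T), ← Finset.mul_sum, hmT] at h
    refine mul_left_cancel₀ h8 (h.trans ?_)
    ring
  have hfb : ∀ z, ∑ x, chi (x * z) * b x = 4 * T * chi (mu * z ^ (2 ^ i + 1)) := fun z => by
    have h := sum_chi_mul_powWalsh (e := 2 ^ i + 1) hm0 mu z
    simp only [hWb, mul_left_comm _ (8 * T), ← Finset.mul_sum, hmT] at h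
    refine mul_left_cancel₀ h8 (h.trans ?_)
    ring
  have hA : ∑ x, a x = 4 * T := by
    simpa [zero_pow he0, chi_zero] using hfa 0
  have hB : ∑ x, b x = 4 * T := by
    simpa [zero_pow he0, chi_zero] using hfb 0
  have hA2 : ∑ x, a x ^ 2 = 16 * T ^ 2 := by
    have h : ∑ x, 2 * a x ^ 2 = 32 * T ^ 2 := by
      simp only [hchia, Finset.sum_sub_distrib, hsum r hr0, hone, sub_zero]
    rw [← Finset.mul_sum] at h
    linarith
  have hB2 : ∑ x, b x ^ 2 = 16 * T ^ 2 := by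
    have h : ∑ x, 2 * b x ^ 2 = 32 * T ^ 2 := by
      simp only [hchib, Finset.sum_sub_distrib, hsum s hs0, hone, sub_zero]
    rw [← Finset.mul_sum] at h
    linarith
  have hP : ∑ x, a x * b x = 0 := by
    have h := sum_powWalsh_mul_powWalsh (e := 2 ^ i + 1) hm0 lam mu
    simp only [hWa, hWb, hc, mul_zero] at h
    have h1 : ∀ x, 8 * T * a x * (8 * T * b x) = 8 * T * (8 * T) * (a x * b x) :=
      fun x => mul_mul_mul_comm _ _ _ _
    rw [Finset.sum_congr rfl fun x _ => h1 x, ← Finset.mul_sum] at h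
    exact (mul_eq_zero.1 h).resolve_left (mul_ne_zero h8 h8)
  have hQ : ∑ x, a x ^ 2 * b x = 4 * T * (tr (mu * lam⁻¹)).val := by
    have h : ∑ x, 2 * (a x ^ 2 * b x) = 4 * T * (1 - chi (mu * lam⁻¹)) := by
      simp only [← mul_assoc, hchia, sub_mul, one_mul, Finset.sum_sub_distrib, hB, hfb, hr]
      ring
    rw [← Finset.mul_sum, one_sub_chi] at h
    linarith
  have hR : ∑ x, a x * b x ^ 2 = 4 * T * (tr (lam * mu⁻¹)).val := by
    have h : ∑ x, 2 * (a x * b x ^ 2) = 4 * T * (1 - chi (lam * mu⁻¹)) := by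
      simp only [mul_comm (a _), ← mul_assoc, hchib, sub_mul, one_mul, Finset.sum_sub_distrib, hA,
        hfa, hs]
      ring
    rw [← Finset.mul_sum, one_sub_chi] at h
    linarith
  have hS : ∑ x, a x ^ 2 * b x ^ 2 = 8 * T ^ 2 := by
    have h : ∑ x, 4 * (a x ^ 2 * b x ^ 2) = 32 * T ^ 2 := by
      have h1 : ∀ x, 4 * (a x ^ 2 * b x ^ 2)
          = 1 - chi (x * r) - chi (x * s) + chi (x * (r + s)) := fun x => by
        rw [mul_add x, chi_add]
        linear_combination 2 * b x ^ 2 * hchia x + (1 - chi (x * r)) * hchib x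
      simp only [h1, Finset.sum_sub_distrib, Finset.sum_add_distrib, hsum r hr0, hsum s hs0,
        hsum _ hrs, hone, sub_zero, add_zero]
    rw [← Finset.mul_sum] at h
    linarith
  have hwt : ∀ x, (wtS (2 ^ i + 1) (lam + mu) lam x : ℤ) = 8 * T ^ 2 + 2 * T * (b x - a x) :=
    fun x => by
      have h := four_mul_wtS hm0 hc x
      rw [hWa, hWb, hmT] at h
      linarith
  have hiff : ∀ (w : ℕ) (j : ℤ), (w : ℤ) = 8 * T ^ 2 + 2 * T * j → ∀ x,
      wtS (2 ^ i + 1) (lam + mu) lam x = w ↔ b x - a x = j := fun w j hw x => by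
    rw [← Nat.cast_inj (R := ℤ), hwt, hw, add_right_inj, mul_right_inj' (by positivity)]
  have hcnt : ∀ (w : ℕ) (j : ℤ), (w : ℤ) = 8 * T ^ 2 + 2 * T * j →
      cntS (2 ^ i + 1) (lam + mu) lam w = (univ.filter fun x => b x - a x = j).card :=
    fun w j hw => congrArg Finset.card (Finset.filter_congr fun x _ => hiff w j hw x)
  have e2 : 2 * (t + 2) + 1 - 2 = 2 * t + 3 := by omega
  have e3 : 2 * (t + 2) + 1 - 3 = 2 * t + 2 := by omega
  have e4 : 2 * (t + 2) + 1 - 4 = 2 * t + 1 := by omega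
  have e5 : t + 2 - 1 = t + 1 := by omega
  have e6 : t + 2 - 2 = t := by omega
  rw [e2, e3, e4, e5, e6]
  have p1 : (2 : ℤ) ^ (2 * t + 3) = 8 * T ^ 2 := by rw [hT]; ring
  have p2 : (2 : ℤ) ^ (t + 2) = 4 * T := by rw [hT]; ring
  have p3 : (2 : ℤ) ^ (t + 1) = 2 * T := by rw [hT]; ring
  have p4 : (2 : ℤ) ^ (2 * t + 2) = 4 * T ^ 2 := by rw [hT]; ring
  have p5 : (2 : ℤ) ^ (2 * t + 1) = 2 * T ^ 2 := by rw [hT]; ring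
  have w1 : ((2 ^ (2 * t + 3) - 2 ^ (t + 2) : ℕ) : ℤ) = 8 * T ^ 2 + 2 * T * (-2) := by
    rw [Nat.cast_sub (Nat.pow_le_pow_right two_pos (by omega))]
    push_cast
    rw [p1, p2]; ring
  have w2 : ((2 ^ (2 * t + 3) - 2 ^ (t + 1) : ℕ) : ℤ) = 8 * T ^ 2 + 2 * T * (-1) := by
    rw [Nat.cast_sub (Nat.pow_le_pow_right two_pos (by omega))]
    push_cast
    rw [p1, p3]; ring
  have w3 : ((2 ^ (2 * t + 3) : ℕ) : ℤ) = 8 * T ^ 2 + 2 * T * 0 := by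
    push_cast
    rw [p1]; ring
  have w4 : ((2 ^ (2 * t + 3) + 2 ^ (t + 1) : ℕ) : ℤ) = 8 * T ^ 2 + 2 * T * 1 := by
    push_cast
    rw [p1, p3]; ring
  have w5 : ((2 ^ (2 * t + 3) + 2 ^ (t + 2) : ℕ) : ℤ) = 8 * T ^ 2 + 2 * T * 2 := by
    push_cast
    rw [p1, p2]; ring
  obtain ⟨c1, c2, c3, c4, c5⟩ := card_filter_sub_eq a b ha hb hA hB hA2 hB2 hP hQ hR hS
  have hcard : (Fintype.card (GF (2 * (t + 2) + 1)) : ℤ) = 32 * T ^ 2 := by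
    rw [card_GF hm0, ← hmT]; push_cast; rfl
  rw [hcard] at c3
  rw [hcnt _ _ w1, hcnt _ _ w2, hcnt _ _ w3, hcnt _ _ w4, hcnt _ _ w5, p1, p3, p4, p5, ← hT]
  refine ⟨fun x => ?_, by linarith, by linarith, by linarith, by linarith, by linarith⟩
  simp only [Set.mem_insert_iff, Set.mem_singleton_iff]
  rw [hiff _ _ w1, hiff _ _ w2, hiff _ _ w3, hiff _ _ w4, hiff _ _ w5]
  rcases ha x with h | h | h <;> rcases hb x with h' | h' | h' <;> rw [h, h'] <;> norm_num
end
end
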